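/- arXiv:2507.23392 — 3 statements merged into one kernel-verified Lean document; each statement's English description precedes it below -/
import Mathlib

section
/- Let X : [0,T] → ℝ^d be a continuously differentiable path and let I, J be multi-indices over {1,…,d}. Writing the shuffle product of the corresponding words as e_I ⧢ e_J = Σ_K c_K e_K (a finite sum over words K of length |I|+|J| with nonnegative integer coefficients c_K), one has the group-like (shuffle) identity S(X)^I_{0,T} · S(X)^J_{0,T} = Σ_K c_K S(X)^K_{0,T}. -/
open MeasureTheory

/-- The signature coefficient `S(X)^I_{s,t}` of a path `X : ℝ → ℝ^d` over `[s,t]`. -/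
noncomputable def sigCoeff {d : ℕ} (X : ℝ → Fin d → ℝ) (s t : ℝ) (I : List (Fin d)) : ℝ :=
  ∫ u in {u : Fin I.length → ℝ |
      (∀ a b : Fin I.length, a < b → u a < u b) ∧ ∀ a, u a ∈ Set.Ioo s t},
    ∏ a : Fin I.length, deriv (fun r => X r (I.get a)) (u a)

/-- The shuffle product of two words, as the list (with multiplicity) of all their shuffles,
so that `e_I ⧢ e_J = Σ_{K ∈ shuffle I J} e_K`. -/
def shuffle {α : Type*} : List α → List α → List (List α)
  | [], J => [J]
  | a :: I, [] => [a :: I]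
  | a :: I, b :: J =>
      ((shuffle I (b :: J)).map (List.cons a)) ++ ((shuffle (a :: I) J).map (List.cons b))
termination_by I J => I.length + J.length

/-- The open simplex `s < u 0 < ⋯ < u (n - 1) < t`. -/
def openSimplex (n : ℕ) (s t : ℝ) : Set (Fin n → ℝ) :=
  {u | (∀ a b : Fin n, a < b → u a < u b) ∧ ∀ a, u a ∈ Set.Ioo s t}

theorem measurableSet_openSimplex (n : ℕ) (s t : ℝ) : MeasurableSet (openSimplex n s t) := by
  unfold openSimplex
  refine MeasurableSet.inter (s₁ := {u : Fin n → ℝ | ∀ a b : Fin n, a < b → u a < u b})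
    (s₂ := {u : Fin n → ℝ | ∀ a, u a ∈ Set.Ioo s t}) ?_ ?_
  · simp only [Set.ofPred_forall]
    exact MeasurableSet.iInter fun a => MeasurableSet.iInter fun b => MeasurableSet.iInter fun _ =>
      measurableSet_lt (measurable_pi_apply a) (measurable_pi_apply b)
  · simp only [Set.ofPred_forall]
    exact MeasurableSet.iInter fun a => measurable_pi_apply a measurableSet_Ioo

theorem cons_mem_openSimplex {n : ℕ} {s t x : ℝ} {u : Fin n → ℝ} :
    (Fin.cons x u : Fin (n + 1) → ℝ) ∈ openSimplex (n + 1) s t ↔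
      x ∈ Set.Ioo s t ∧ u ∈ openSimplex n x t := by
  simp only [openSimplex, Set.mem_ofPred_eq, Fin.forall_fin_succ, Fin.cons_zero, Fin.cons_succ,
    Fin.succ_lt_succ_iff, Fin.succ_pos, Set.mem_Ioo, Fin.not_lt_zero, forall_const,
    false_imp_iff, true_and]
  constructor
  · rintro ⟨⟨h₁, h₂⟩, h₃, h₄⟩
    exact ⟨h₃, h₂, fun a => ⟨h₁ a, (h₄ a).2⟩⟩
  · rintro ⟨h₁, h₂, h₃⟩
    exact ⟨⟨fun a => (h₃ a).1, h₂⟩, h₁, fun a => ⟨h₁.1.trans (h₃ a).1, (h₃ a).2⟩⟩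

theorem integrableOn_openSimplex {n : ℕ} {g : (Fin n → ℝ) → ℝ} (hg : Continuous g) (s t : ℝ) :
    IntegrableOn g (openSimplex n s t) := by
  refine (hg.continuousOn.integrableOn_compact
    (isCompact_univ_pi fun _ : Fin n => isCompact_Icc (a := s) (b := t))).mono_set ?_
  intro u hu a _
  exact Set.Ioo_subset_Icc_self (hu.2 a)

theorem setIntegral_openSimplex_succ {n : ℕ} {f : Fin (n + 1) → ℝ → ℝ}
    (hf : ∀ i, Continuous (f i)) {s t : ℝ} (hst : s ≤ t) :
    ∫ u in openSimplex (n + 1) s t, ∏ a, f a (u a) =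
      ∫ x in s..t, f 0 x * ∫ u in openSimplex n x t, ∏ a : Fin n, f a.succ (u a) := by
  have hint := (integrable_indicator_iff (measurableSet_openSimplex (n + 1) s t)).2
    (integrableOn_openSimplex (g := fun u => ∏ a, f a (u a)) (by fun_prop) s t)
  have hmp := (volume_preserving_piFinSuccAbove (fun _ : Fin (n + 1) => ℝ) 0).symm
  rw [← integral_indicator (measurableSet_openSimplex _ _ _), ← hmp.integral_comp',
    Measure.volume_eq_prod, integral_prod, intervalIntegral.integral_of_le hst,
    integral_Ioc_eq_integral_Ioo, ← integral_indicator measurableSet_Ioo]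
  · congr 1 with x
    have key (u : Fin n → ℝ) :
        (openSimplex (n + 1) s t).indicator (fun u => ∏ a, f a (u a))
          ((MeasurableEquiv.piFinSuccAbove (fun _ : Fin (n + 1) => ℝ) 0).symm (x, u)) =
        (Set.Ioo s t).indicator (fun x => f 0 x *
          (openSimplex n x t).indicator (fun u => ∏ a : Fin n, f a.succ (u a)) u) x := by
      have hcons : (MeasurableEquiv.piFinSuccAbove (fun _ : Fin (n + 1) => ℝ) 0).symm (x, u) =
          (Fin.cons x u : Fin (n + 1) → ℝ) := by
        simp [MeasurableEquiv.piFinSuccAbove, Fin.consEquiv]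
      rw [hcons]
      by_cases hx : x ∈ Set.Ioo s t <;> by_cases hu : u ∈ openSimplex n x t <;>
        simp [Set.indicator, cons_mem_openSimplex, hx, hu, Fin.prod_univ_succ, -Set.mem_Ioo]
    simp only [key]
    by_cases hx : x ∈ Set.Ioo s t
    · simp only [Set.indicator_of_mem hx]
      rw [integral_const_mul, integral_indicator (measurableSet_openSimplex _ _ _)]
    · simp only [Set.indicator_of_notMem hx, integral_zero]
  · exact (hmp.integrable_comp_emb (MeasurableEquiv.measurableEmbedding _)).2 hint

/-- Iterated integrals over `[s, t]` of the functions `f i`, with `i` ranging over a word, the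
first letter being integrated last. -/
noncomputable def iterInt {α : Type*} (f : α → ℝ → ℝ) (t : ℝ) : List α → ℝ → ℝ
  | [], _ => 1
  | i :: I, s => ∫ u in s..t, f i u * iterInt f t I u

section iterInt

variable {α : Type*} {f : α → ℝ → ℝ}

@[simp]
theorem iterInt_cons_self (t : ℝ) (i : α) (I : List α) : iterInt f t (i :: I) t = 0 := by
  simp [iterInt]

theorem continuous_iterInt (hf : ∀ i, Continuous (f i)) (t : ℝ) (I : List α) :
    Continuous (iterInt f t I) := by
  induction I with
  | nil => exact continuous_const
  | cons i I ih =>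
    have hc : Continuous fun u => f i u * iterInt f t I u := (hf i).mul ih
    have h : iterInt f t (i :: I) = fun s => -∫ u in t..s, f i u * iterInt f t I u := by
      funext s
      rw [iterInt, intervalIntegral.integral_symm]
    rw [h]
    exact (intervalIntegral.continuous_primitive (fun a b => hc.intervalIntegrable a b) t).neg

theorem hasDerivAt_iterInt_cons (hf : ∀ i, Continuous (f i)) (t : ℝ) (i : α) (I : List α)
    (s : ℝ) : HasDerivAt (iterInt f t (i :: I)) (-(f i s * iterInt f t I s)) s := by
  have hc : Continuous fun u => f i u * iterInt f t I u := (hf i).mul (continuous_iterInt hf t I)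
  exact intervalIntegral.integral_hasDerivAt_left (hc.intervalIntegrable s t)
    (hc.stronglyMeasurableAtFilter _ _) hc.continuousAt

theorem hasDerivAt_sum_iterInt_cons (hf : ∀ i, Continuous (f i)) (t : ℝ) (i : α)
    (L : List (List α)) (s : ℝ) :
    HasDerivAt (fun s => (L.map fun K => iterInt f t (i :: K) s).sum)
      (-(f i s * (L.map fun K => iterInt f t K s).sum)) s := by
  induction L with
  | nil => simpa using hasDerivAt_const s (0 : ℝ)
  | cons K L ih =>
    simp only [List.map_cons, List.sum_cons]
    exact ((hasDerivAt_iterInt_cons hf t i K s).add ih).congr_deriv (by ring)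

theorem iterInt_mul_iterInt (hf : ∀ i, Continuous (f i)) (t : ℝ) (I J : List α) (s : ℝ) :
    iterInt f t I s * iterInt f t J s =
      ((shuffle I J).map fun K => iterInt f t K s).sum := by
  induction I, J using shuffle.induct generalizing s with
  | case1 J => simp [shuffle, iterInt]
  | case2 a I => simp [shuffle, iterInt]
  | case3 a I b J ihI ihJ =>
    have hderiv (x : ℝ) := ((hasDerivAt_iterInt_cons hf t a I x).mul
      (hasDerivAt_iterInt_cons hf t b J x)).sub
      ((hasDerivAt_sum_iterInt_cons hf t a (shuffle I (b :: J)) x).add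
        (hasDerivAt_sum_iterInt_cons hf t b (shuffle (a :: I) J) x))
    have hconst := is_const_of_deriv_eq_zero (fun x => (hderiv x).differentiableAt)
      (fun x => (hderiv x).deriv.trans (by rw [← ihI, ← ihJ]; ring)) s t
    simp only [Pi.sub_apply, Pi.mul_apply, Pi.add_apply, iterInt_cons_self, mul_zero,
      List.map_const', List.sum_replicate, smul_zero, add_zero, sub_zero] at hconst
    rw [shuffle]
    simp only [List.map_append, List.map_map, List.sum_append, Function.comp_def]
    linarith

end iterInt

theorem sigCoeff_eq_iterInt {d : ℕ} {X : ℝ → Fin d → ℝ}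
    (hX : ∀ i, Continuous (deriv fun r => X r i)) {s t : ℝ} (hst : s ≤ t) (I : List (Fin d)) :
    sigCoeff X s t I = iterInt (fun i => deriv fun r => X r i) t I s := by
  induction I generalizing s with
  | nil =>
    have : (volume : Measure (Fin 0 → ℝ)) Set.univ = 1 := by
      rw [volume_pi, Measure.pi_of_empty (fun _ : Fin 0 => volume) 0, measure_univ]
    simp [sigCoeff, iterInt, Measure.real, this]
  | cons i I ih =>
    refine (setIntegral_openSimplex_succ (n := I.length)
      (f := fun a => deriv fun r => X r ((i :: I).get a)) (fun a => hX _) hst).trans ?_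
    rw [iterInt]
    refine intervalIntegral.integral_congr fun x hx => ?_
    rw [Set.uIcc_of_le hst] at hx
    exact congrArg _ (ih hx.2)

/-- **Group-like (shuffle) identity for signatures.** For a continuously differentiable path
`X : [0,T] → ℝ^d` and multi-indices `I, J`, writing `e_I ⧢ e_J = Σ_K c_K e_K`,
one has `S(X)^I_{0,T} ⬝ S(X)^J_{0,T} = Σ_K c_K S(X)^K_{0,T}`. -/
theorem sig_shuffle_identity {d : ℕ} (T : ℝ) (hT : 0 ≤ T) (X : ℝ → Fin d → ℝ)
    (hX : ContDiff ℝ 1 X) (I J : List (Fin d)) :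
    sigCoeff X 0 T I * sigCoeff X 0 T J =
      ((shuffle I J).map (fun K => sigCoeff X 0 T K)).sum := by
  have hX' (i : Fin d) : Continuous (deriv fun r => X r i) :=
    (contDiff_pi.1 hX i).continuous_deriv le_rfl
  simp only [sigCoeff_eq_iterInt hX' hT]
  exact iterInt_mul_iterInt hX' T I J 0
end

section
/- Let V be a finite-dimensional real normed vector space, let p ≥ 1, and let N be an integer with N > p. Let X, Y : Δ_T → T^N(V) be multiplicative functionals of degree N, each of finite p-variation, i.e., for each 1 ≤ k ≤ N, sup_D Σ_{t_i∈D} ‖π_k(X_{t_i,t_{i+1}})‖^{p/k} < ∞ and likewise for Y, the supremum being over all finite partitions D of [0,T] and the tensor powers V^{⊗k} carrying fixed norms. If π_k(X_{s,t}) = π_k(Y_{s,t}) for all 0 ≤ k ≤ N−1 and all (s,t) ∈ Δ_T, then X_{s,t} = Y_{s,t} for all (s,t) ∈ Δ_T. -/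
/-- The coordinate model of the `k`-th tensor power `V^{⊗k}` of `V = ℝ^d`:
real-valued functions on multi-indices `(i_1,…,i_k) ∈ {1,…,d}^k`. -/
abbrev Tens (d k : ℕ) := (Fin k → Fin d) → ℝ

/-- The graded product `(a ⊗ b)_n = Σ_{i+j=n} a_i ⊗ b_j` on ℕ-graded tensors in
coordinates, using the canonical identification `V^{⊗i} ⊗ V^{⊗j} ≅ V^{⊗(i+j)}`. -/
noncomputable def etMul {d : ℕ} (a b : ∀ n : ℕ, Tens d n) : ∀ n : ℕ, Tens d n :=
  fun n w => ∑ i : Fin (n + 1),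
    a (i : ℕ) (fun x => w ⟨(x : ℕ), by have := x.isLt; have := i.isLt; omega⟩) *
    b (n - (i : ℕ)) (fun y => w ⟨(i : ℕ) + (y : ℕ), by have := y.isLt; omega⟩)

/-- The truncated tensor algebra `T^N(V) = ⊕_{k=0}^N V^{⊗k}` over `V = ℝ^d`,
in coordinates. -/
abbrev TTA (d N : ℕ) := ∀ k : Fin (N + 1), Tens d k

/-- Extension of an element of `T^N(V)` by zero to all degrees. -/
def extendTTA {d N : ℕ} (a : TTA d N) : ∀ n : ℕ, Tens d n :=
  fun n => if h : n < N + 1 then a ⟨n, h⟩ else 0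

/-- The truncated tensor product on `T^N(V)`: `(a ⊗ b)_n = Σ_{i+j=n} a_i ⊗ b_j`
for `n ≤ N`. -/
noncomputable def ttaMul {d N : ℕ} (a b : TTA d N) : TTA d N :=
  fun k => etMul (extendTTA a) (extendTTA b) (k : ℕ)

/-- The simplex `Δ_T = {(s,t) : 0 ≤ s ≤ t ≤ T}`. -/
def DeltaSet (T : ℝ) : Set (ℝ × ℝ) := {q | 0 ≤ q.1 ∧ q.1 ≤ q.2 ∧ q.2 ≤ T}

/-- A multiplicative functional of degree `N`: a continuous map `X : Δ_T → T^N(V)`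
with `π_0(X_{s,t}) = 1` and `X_{s,t} = X_{s,u} ⊗ X_{u,t}` for all `0 ≤ s ≤ u ≤ t ≤ T`. -/
def IsMultFunc {d N : ℕ} (T : ℝ) (X : ℝ × ℝ → TTA d N) : Prop :=
  ContinuousOn X (DeltaSet T) ∧
  (∀ s t : ℝ, (s, t) ∈ DeltaSet T → X (s, t) 0 = fun _ => 1) ∧
  (∀ s u t : ℝ, 0 ≤ s → s ≤ u → u ≤ t → t ≤ T →
    X (s, t) = ttaMul (X (s, u)) (X (u, t)))

open scoped ENNReal

/-- The level-`k` `p`-variation supremum of a functional `X : Δ_T → T^N(V)`: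
`sup_D Σ_{t_i ∈ D} ‖π_k(X_{t_i,t_{i+1}})‖^{p/k}`, over all finite partitions `D` of
`[0,T]`, with `V^{⊗k}` carrying its (fixed) sup norm. -/
noncomputable def levelVarSup {d N : ℕ} (T p : ℝ) (X : ℝ × ℝ → TTA d N)
    (k : Fin (N + 1)) : ℝ≥0∞ :=
  ⨆ (n : ℕ) (tt : Fin (n + 1) → ℝ) (_ : Monotone tt) (_ : tt 0 = 0)
      (_ : tt (Fin.last n) = T),
    ∑ i : Fin n, ENNReal.ofReal (‖X (tt i.castSucc, tt i.succ) k‖ ^ (p / (k : ℕ)))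

/-- A continuous function whose `q`-variation along uniform partitions is bounded for some
`q < 1` takes the same value at both endpoints. -/
theorem eq_of_continuousOn_of_sum_rpow_le {E : Type*} [NormedAddCommGroup E] {f : ℝ → E}
    {t q C : ℝ} (ht : 0 ≤ t) (hq : q < 1) (hf : ContinuousOn f (Set.Icc 0 t))
    (hC : ∀ n : ℕ, 0 < n →
      ∑ i ∈ Finset.range n, ‖f ((i + 1 : ℕ) * (t / n)) - f (i * (t / n))‖ ^ q ≤ C) :
    f t = f 0 := by
  have key : ∀ ε > 0, ‖f t - f 0‖ ≤ ε ^ (1 - q) * C := by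
    intro ε hε
    obtain ⟨δ, hδ, h⟩ := Metric.uniformContinuousOn_iff.1
      (isCompact_Icc.uniformContinuousOn_of_continuous hf) ε hε
    obtain ⟨n, hn⟩ := exists_nat_gt (t / δ)
    have hn0 : (0 : ℝ) < n := (div_nonneg ht hδ.le).trans_lt hn
    have hstep : t / n < δ := by
      rw [div_lt_iff₀ hδ] at hn
      rw [div_lt_iff₀ hn0]
      linarith
    have hmem : ∀ i : ℕ, i ≤ n → (i : ℝ) * (t / n) ∈ Set.Icc 0 t := by
      intro i hi
      refine ⟨by positivity, ?_⟩
      calc (i : ℝ) * (t / n) ≤ n * (t / n) := by gcongr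
        _ = t := by field_simp
    have htel := Finset.sum_range_sub (fun i : ℕ => f (i * (t / n))) n
    have hend : (n : ℝ) * (t / n) = t := by field_simp
    simp only [hend, Nat.cast_zero, zero_mul] at htel
    calc ‖f t - f 0‖
        ≤ ∑ i ∈ Finset.range n, ‖f ((i + 1 : ℕ) * (t / n)) - f (i * (t / n))‖ := by
          rw [← htel]
          exact norm_sum_le _ _
      _ ≤ ∑ i ∈ Finset.range n,
            ε ^ (1 - q) * ‖f ((i + 1 : ℕ) * (t / n)) - f (i * (t / n))‖ ^ q := by
          refine Finset.sum_le_sum fun i hi => ?_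
          have hi' := Finset.mem_range.1 hi
          have hsmall : ‖f ((i + 1 : ℕ) * (t / n)) - f (i * (t / n))‖ ≤ ε := by
            rw [← dist_eq_norm]
            refine (h _ (hmem _ hi') _ (hmem _ hi'.le) ?_).le
            rw [Real.dist_eq, ← sub_mul, Nat.cast_succ, add_sub_cancel_left, one_mul,
              abs_of_nonneg (by positivity)]
            exact hstep
          rcases (norm_nonneg (f ((i + 1 : ℕ) * (t / n)) - f (i * (t / n)))).eq_or_lt with
            hx | hx
          · rw [← hx]
            positivity
          · generalize ‖f ((i + 1 : ℕ) * (t / n)) - f (i * (t / n))‖ = x at hsmall hx ⊢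
            calc x = x ^ (1 - q) * x ^ q := by
                  rw [← Real.rpow_add hx, sub_add_cancel, Real.rpow_one]
              _ ≤ _ := by
                  gcongr
      _ ≤ ε ^ (1 - q) * C := by
          rw [← Finset.mul_sum]
          gcongr
          exact hC n (by exact_mod_cast hn0)
  have hlim : Filter.Tendsto (fun ε : ℝ => ε ^ (1 - q) * C) (nhdsWithin 0 (Set.Ioi 0))
      (nhds 0) := by
    have h1 : ContinuousAt (fun ε : ℝ => ε ^ (1 - q) * C) 0 :=
      (Real.continuousAt_rpow_const 0 (1 - q) (Or.inr (by linarith))).mul_const C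
    have h2 := h1.tendsto.mono_left (nhdsWithin_le_nhds (s := Set.Ioi 0))
    simpa [Real.zero_rpow (sub_pos.2 hq).ne'] using h2
  have h0 : ‖f t - f 0‖ ≤ 0 :=
    ge_of_tendsto hlim (eventually_nhdsWithin_of_forall key)
  exact sub_eq_zero.1 (norm_le_zero_iff.1 h0)

theorem sum_rpow_le_levelVarSup {d N : ℕ} {T p t : ℝ} {X : ℝ × ℝ → TTA d N}
    {k : Fin (N + 1)} (hvar : levelVarSup T p X k ≠ ⊤) (ht : 0 ≤ t) (htT : t ≤ T)
    {n : ℕ} (hn : 0 < n) :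
    ∑ i ∈ Finset.range n, ‖X (i * (t / n), (i + 1 : ℕ) * (t / n)) k‖ ^ (p / (k : ℕ)) ≤
      (levelVarSup T p X k).toReal := by
  have hn0 : (0 : ℝ) < n := by exact_mod_cast hn
  let u : ℕ → ℝ := fun i => if i ≤ n then i * (t / n) else T
  have hle : ∀ i ≤ n, (i : ℝ) * (t / n) ≤ T := by
    intro i hi
    calc (i : ℝ) * (t / n) ≤ n * (t / n) := by gcongr
      _ = t := by field_simp
      _ ≤ T := htT
  have hu : Monotone u := by
    intro i j hij
    by_cases hj : j ≤ n
    · simp only [u, hj, hij.trans hj, if_true]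
      gcongr
    · by_cases hi : i ≤ n
      · simp only [u, hi, hj, if_true, if_false]
        exact hle i hi
      · simp [u, hi, hj]
  have hsup : ∑ i : Fin (n + 1), ENNReal.ofReal (‖X (u i, u (i + 1 : ℕ)) k‖ ^ (p / (k : ℕ))) ≤
      levelVarSup T p X k := by
    unfold levelVarSup
    refine le_iSup_of_le (n + 1) (le_iSup_of_le (fun i : Fin (n + 2) => u i)
      (le_iSup_of_le (fun i j hij => hu hij) (le_iSup_of_le (by simp [u])
        (le_iSup_of_le (by simp [u]) ?_))))
    simp
  rw [← ENNReal.ofReal_le_iff_le_toReal hvar, ENNReal.ofReal_sum_of_nonneg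
    (fun i _ => by positivity)]
  refine le_trans ?_ hsup
  rw [Fin.sum_univ_eq_sum_range
    (fun i => ENNReal.ofReal (‖X (u i, u (i + 1 : ℕ)) k‖ ^ (p / (k : ℕ)))),
    Finset.sum_range_succ]
  refine le_trans (le_of_eq (Finset.sum_congr rfl fun i hi => ?_)) le_self_add
  have hi' := Finset.mem_range.1 hi
  simp only [u, hi'.le, Nat.succ_le_of_lt hi', if_true]

theorem extendTTA_apply_of_eq {d N m : ℕ} (a : TTA d N) (h : m = N) (w : Fin N → Fin d)
    (g : Fin m → Fin N) (hg : ∀ y, (g y : ℕ) = y) :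
    extendTTA a m (fun y => w (g y)) = a (Fin.last N) w := by
  subst h
  have : g = id := funext fun y => Fin.ext (hg y)
  simp [extendTTA, this, Fin.last]

theorem extendTTA_zero_apply {d N : ℕ} (a : TTA d N) (ha : a 0 = fun _ => 1)
    (w : Fin 0 → Fin d) : extendTTA a 0 w = 1 := by
  simpa [extendTTA] using congrFun ha w

theorem extendTTA_congr {d N m : ℕ} {a b : TTA d N}
    (hab : ∀ k : Fin (N + 1), (k : ℕ) ≤ N - 1 → a k = b k) (hm : m ≤ N - 1) :
    extendTTA a m = extendTTA b m := by
  have h : m < N + 1 := by omega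
  simpa [extendTTA, h] using hab ⟨m, h⟩ hm

/-- If two pairs of elements with scalar part `1` agree below the top level, the top level of
the difference of their products is the sum of the differences of their top levels. -/
theorem ttaMul_last_sub {d N : ℕ} (hN : 0 < N) {a b a' b' : TTA d N}
    (ha : a 0 = fun _ => 1) (hb : b 0 = fun _ => 1)
    (haa : ∀ k : Fin (N + 1), (k : ℕ) ≤ N - 1 → a k = a' k)
    (hbb : ∀ k : Fin (N + 1), (k : ℕ) ≤ N - 1 → b k = b' k) :
    ttaMul a b (Fin.last N) - ttaMul a' b' (Fin.last N) =
      (a (Fin.last N) - a' (Fin.last N)) + (b (Fin.last N) - b' (Fin.last N)) := by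
  have ha' : a' 0 = fun _ => 1 := (haa 0 (by simp)).symm.trans ha
  have hb' : b' 0 = fun _ => 1 := (hbb 0 (by simp)).symm.trans hb
  have hlast : ∀ {c : TTA d N} {m : ℕ} (_ : c 0 = fun _ => 1) (_ : m = 0)
      (v : Fin m → Fin d), extendTTA c m v = 1 := by
    rintro c m hc rfl v
    exact extendTTA_zero_apply c hc v
  obtain ⟨M, rfl⟩ : ∃ M, N = M + 1 := ⟨N - 1, by omega⟩
  ext w
  have hexpand : ∀ {c e : TTA d (M + 1)} (_ : c 0 = fun _ => 1) (_ : e 0 = fun _ => 1),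
      ttaMul c e (Fin.last (M + 1)) w = e (Fin.last _) w + (∑ i : Fin M,
        extendTTA c (i + 1) (fun x => w ⟨x, by have := x.isLt; simp only [Fin.val_last]; omega⟩) *
        extendTTA e (M + 1 - (i + 1))
          (fun y => w ⟨i + 1 + y, by have := y.isLt; simp only [Fin.val_last]; omega⟩)) +
        c (Fin.last _) w := by
    intro c e hc he
    change etMul (extendTTA c) (extendTTA e) (M + 1) w = _
    unfold etMul
    rw [Fin.sum_univ_succ, Fin.sum_univ_castSucc, ← add_assoc]
    congr 1
    · congr 1
      rw [hlast (m := ((0 : Fin (M + 1 + 1)) : ℕ)) hc rfl, one_mul]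
      exact extendTTA_apply_of_eq e (by simp) w _ (by simp)
    · rw [hlast he (by simp), mul_one]
      exact extendTTA_apply_of_eq c (by simp) w _ (by simp)
  simp only [Pi.sub_apply, Pi.add_apply]
  rw [hexpand ha hb, hexpand ha' hb']
  have hmid : ∀ i : Fin M, extendTTA a (i + 1) = extendTTA a' (i + 1) ∧
      extendTTA b (M + 1 - (i + 1)) = extendTTA b' (M + 1 - (i + 1)) := fun i =>
    ⟨extendTTA_congr haa (by omega), extendTTA_congr hbb (by omega)⟩
  simp only [hmid]
  ring

/-- **Uniqueness of the top level beyond degree `⌊p⌋`.** Let `p ≥ 1` and `N > p`. If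
`X, Y : Δ_T → T^N(V)` are multiplicative functionals of degree `N`, each of finite
`p`-variation at every level `1 ≤ k ≤ N`, and they agree on levels `0,…,N−1`, then
`X_{s,t} = Y_{s,t}` on all of `Δ_T`. -/
theorem multiplicative_functional_unique_top_level {d N : ℕ} (T p : ℝ) (hp : 1 ≤ p)
    (hNp : p < (N : ℝ))
    (X Y : ℝ × ℝ → TTA d N) (hX : IsMultFunc T X) (hY : IsMultFunc T Y)
    (hXvar : ∀ k : Fin (N + 1), 1 ≤ (k : ℕ) → levelVarSup T p X k ≠ ⊤)
    (hYvar : ∀ k : Fin (N + 1), 1 ≤ (k : ℕ) → levelVarSup T p Y k ≠ ⊤)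
    (hagree : ∀ k : Fin (N + 1), (k : ℕ) ≤ N - 1 → ∀ q ∈ DeltaSet T, X q k = Y q k) :
    ∀ q ∈ DeltaSet T, X q = Y q := by
  have hN0 : (0 : ℝ) < N := by linarith
  have hN : 0 < N := by exact_mod_cast hN0
  obtain ⟨hXc, hX1, hXm⟩ := hX
  obtain ⟨hYc, -, hYm⟩ := hY
  let D : ℝ × ℝ → Tens d N := fun q => X q (Fin.last N) - Y q (Fin.last N)
  have hadd : ∀ s u t, 0 ≤ s → s ≤ u → u ≤ t → t ≤ T → D (s, t) = D (s, u) + D (u, t) := by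
    intro s u t hs hsu hut ht
    have h1 : (s, u) ∈ DeltaSet T := ⟨hs, hsu, hut.trans ht⟩
    have h2 : (u, t) ∈ DeltaSet T := ⟨hs.trans hsu, hut, ht⟩
    simp only [D]
    rw [hXm s u t hs hsu hut ht, hYm s u t hs hsu hut ht]
    exact ttaMul_last_sub hN (hX1 _ _ h1) (hX1 _ _ h2) (fun k hk => hagree k hk _ h1)
      (fun k hk => hagree k hk _ h2)
  have hDc : ContinuousOn D (DeltaSet T) :=
    ((continuous_apply (Fin.last N)).comp_continuousOn hXc).sub
      ((continuous_apply (Fin.last N)).comp_continuousOn hYc)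
  have hq0 : 0 ≤ p / N := by positivity
  have hq1 : p / N < 1 := (div_lt_one hN0).2 hNp
  have hzero : ∀ t, 0 ≤ t → t ≤ T → D (0, t) = 0 := by
    intro t ht htT
    have h00 : D (0, 0) = 0 := by
      simpa using hadd 0 0 0 le_rfl le_rfl le_rfl (ht.trans htT)
    rw [← h00]
    refine eq_of_continuousOn_of_sum_rpow_le (f := fun r => D (0, r)) ht hq1
      (C := (levelVarSup T p X (Fin.last N)).toReal + (levelVarSup T p Y (Fin.last N)).toReal)
      (hDc.comp (by fun_prop) fun r hr => ⟨le_rfl, hr.1, hr.2.trans htT⟩) fun n hn => ?_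
    have hn0 : (0 : ℝ) < n := by exact_mod_cast hn
    refine le_trans ?_ <| add_le_add
      (sum_rpow_le_levelVarSup (hXvar (Fin.last N) hN) ht htT hn)
      (sum_rpow_le_levelVarSup (hYvar (Fin.last N) hN) ht htT hn)
    rw [← Finset.sum_add_distrib]
    refine Finset.sum_le_sum fun i hi => ?_
    have hi' : ((i + 1 : ℕ) : ℝ) ≤ n := by exact_mod_cast Finset.mem_range.1 hi
    have hend : ((i + 1 : ℕ) : ℝ) * (t / n) ≤ T := by
      calc ((i + 1 : ℕ) : ℝ) * (t / n) ≤ n * (t / n) := by gcongr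
        _ = t := by field_simp
        _ ≤ T := htT
    have hstep : (i : ℝ) * (t / n) ≤ (i + 1 : ℕ) * (t / n) := by
      gcongr
      exact Nat.le_succ i
    rw [hadd 0 (i * (t / n)) ((i + 1 : ℕ) * (t / n)) le_rfl (by positivity) hstep hend,
      add_sub_cancel_left]
    calc ‖D (i * (t / n), (i + 1 : ℕ) * (t / n))‖ ^ (p / N)
        ≤ (‖X (i * (t / n), (i + 1 : ℕ) * (t / n)) (Fin.last N)‖ +
            ‖Y (i * (t / n), (i + 1 : ℕ) * (t / n)) (Fin.last N)‖) ^ (p / N) := by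
          gcongr
          exact norm_sub_le _ _
      _ ≤ _ := Real.rpow_add_le_add_rpow (norm_nonneg _) (norm_nonneg _) hq0 hq1.le
  rintro ⟨s, t⟩ ⟨hs, hst, ht⟩
  funext k
  by_cases hk : (k : ℕ) ≤ N - 1
  · exact hagree k hk _ ⟨hs, hst, ht⟩
  · obtain rfl : k = Fin.last N := Fin.ext (by simp only [Fin.val_last]; omega)
    have h := hadd 0 s t le_rfl hs hst ht
    rw [hzero t (hs.trans hst) ht, hzero s hs (hst.trans ht), zero_add] at h
    exact sub_eq_zero.1 h.symm
end

section
/- Let X, Y : [0,T] → ℝ^d be continuously differentiable paths with X_0 = Y_0, and let X̂_t = (t, X_t), Ŷ_t = (t, Y_t) be their time-augmentations. If S(X̂)^I_{0,T} = S(Ŷ)^I_{0,T} for every multi-index I over the alphabet {0,1,…,d}, then X_t = Y_t for all t ∈ [0,T]. (Uniqueness of the signature for time-augmented paths.) -/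
open MeasureTheory

/-- The time-augmented path `X̂_t = (t, X_t) ∈ ℝ^{1+d}`, with coordinate `0` being time. -/
noncomputable def timeAug {d : ℕ} (X : ℝ → Fin d → ℝ) : ℝ → Fin (d + 1) → ℝ :=
  fun t => Fin.cons t (X t)

lemma measurableSet_orderedSimplex (n : ℕ) (s t : ℝ) :
    MeasurableSet {u : Fin n → ℝ | (∀ a b : Fin n, a < b → u a < u b) ∧
      ∀ a, u a ∈ Set.Ioo s t} := by
  simp only [Set.ofPred_and, Set.ofPred_forall]
  exact (MeasurableSet.iInter fun a => MeasurableSet.iInter fun b => MeasurableSet.iInter fun _ =>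
      measurableSet_lt (measurable_pi_apply a) (measurable_pi_apply b)).inter
    (MeasurableSet.iInter fun a => measurableSet_Ioo.preimage (measurable_pi_apply a))

lemma integrableOn_orderedSimplex {n : ℕ} (s t : ℝ) {F : (Fin n → ℝ) → ℝ} (hF : Continuous F) :
    IntegrableOn F {u : Fin n → ℝ | (∀ a b : Fin n, a < b → u a < u b) ∧
      ∀ a, u a ∈ Set.Ioo s t} := by
  refine (hF.continuousOn.integrableOn_compact
    (isCompact_univ_pi fun _ : Fin n => isCompact_Icc (a := s) (b := t))).mono_set ?_
  exact fun u hu a _ => Set.Ioo_subset_Icc_self (hu.2 a)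

lemma cons_mem_orderedSimplex_iff {n : ℕ} (s t x : ℝ) (y : Fin n → ℝ) :
    ((∀ a b : Fin (n + 1), a < b →
        (Fin.cons x y : Fin (n + 1) → ℝ) a < (Fin.cons x y : Fin (n + 1) → ℝ) b) ∧
      ∀ a, (Fin.cons x y : Fin (n + 1) → ℝ) a ∈ Set.Ioo s t) ↔
    x ∈ Set.Ioo s t ∧ (∀ a b : Fin n, a < b → y a < y b) ∧ ∀ a, y a ∈ Set.Ioo x t := by
  simp only [Fin.forall_fin_succ, Fin.cons_zero, Fin.cons_succ, Fin.succ_lt_succ_iff,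
    Set.mem_Ioo, Fin.succ_pos, Fin.not_lt_zero, false_imp_iff, true_imp_iff, true_and]
  constructor
  · rintro ⟨⟨h1, h2⟩, h3, h4⟩
    exact ⟨h3, h2, fun a => ⟨h1 a, (h4 a).2⟩⟩
  · rintro ⟨h1, h2, h3⟩
    exact ⟨⟨fun a => (h3 a).1, h2⟩, h1, fun a => ⟨h1.1.trans (h3 a).1, (h3 a).2⟩⟩

/-- Integrating over the ordered simplex by fixing the smallest variable last. -/
lemma setIntegral_orderedSimplex_succ {n : ℕ} (s t : ℝ) {f : Fin (n + 1) → ℝ → ℝ}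
    (hf : ∀ a, Continuous (f a)) :
    ∫ u in {u : Fin (n + 1) → ℝ | (∀ a b : Fin (n + 1), a < b → u a < u b) ∧
        ∀ a, u a ∈ Set.Ioo s t}, ∏ a, f a (u a) =
      ∫ x in Set.Ioo s t, f 0 x *
        ∫ y in {y : Fin n → ℝ | (∀ a b : Fin n, a < b → y a < y b) ∧
          ∀ a, y a ∈ Set.Ioo x t}, ∏ a, f a.succ (y a) := by
  have hF : Continuous fun u : Fin (n + 1) → ℝ => ∏ a, f a (u a) :=
    continuous_finsetProd _ fun a _ => (hf a).comp (continuous_apply a)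
  have hint := integrableOn_orderedSimplex s t hF
  rw [← integrable_indicator_iff (measurableSet_orderedSimplex _ _ _)] at hint
  have hmp := (volume_preserving_piFinSuccAbove (fun _ : Fin (n + 1) => ℝ) 0).symm
  replace hint := (hmp.integrable_comp_emb (MeasurableEquiv.measurableEmbedding _)).2 hint
  simp only [Function.comp_def, Measure.volume_eq_prod] at hint
  rw [← integral_indicator (measurableSet_orderedSimplex _ _ _), ← hmp.integral_comp',
    Measure.volume_eq_prod, integral_prod _ hint,
    ← integral_indicator measurableSet_Ioo]
  refine integral_congr_ae (Filter.Eventually.of_forall fun x => ?_)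
  have hcons (y : Fin n → ℝ) :
      (MeasurableEquiv.piFinSuccAbove (fun _ : Fin (n + 1) => ℝ) 0).symm (x, y) =
        Fin.cons x y := by
    simp [MeasurableEquiv.piFinSuccAbove, Fin.insertNthEquiv]
  simp only [hcons, Set.indicator_apply, Set.mem_ofPred_eq, cons_mem_orderedSimplex_iff]
  by_cases hx : x ∈ Set.Ioo s t
  · rw [if_pos hx, ← integral_const_mul,
      ← integral_indicator (measurableSet_orderedSimplex _ _ _)]
    simp [hx.1, hx.2, Set.indicator_apply, Fin.prod_univ_succ]
  · simp [hx]

lemma sigCoeff_cons {d : ℕ} {X : ℝ → Fin d → ℝ} (hX : ContDiff ℝ 1 X) (s t : ℝ) (i : Fin d)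
    (I : List (Fin d)) :
    sigCoeff X s t (i :: I) =
      ∫ x in Set.Ioo s t, deriv (fun r => X r i) x * sigCoeff X x t I :=
  setIntegral_orderedSimplex_succ (f := fun a => deriv fun r => X r ((i :: I).get a)) s t
    fun _ => (contDiff_pi.1 hX _).continuous_deriv le_rfl

lemma contDiff_timeAug {d : ℕ} {X : ℝ → Fin d → ℝ} (hX : ContDiff ℝ 1 X) :
    ContDiff ℝ 1 (timeAug X) := by
  refine contDiff_pi.2 fun i => ?_
  cases i using Fin.cases with
  | zero => simpa [timeAug] using! contDiff_id
  | succ i => simpa [timeAug] using contDiff_pi.1 hX i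

lemma setIntegral_Ioo_sub_pow_div_factorial (n : ℕ) {s t : ℝ} (h : s ≤ t) :
    ∫ x in Set.Ioo s t, (t - x) ^ n / (n.factorial : ℝ) =
      (t - s) ^ (n + 1) / ((n + 1).factorial : ℝ) := by
  rw [← integral_Ioc_eq_integral_Ioo, ← intervalIntegral.integral_of_le h,
    intervalIntegral.integral_comp_sub_left (fun x => x ^ n / (n.factorial : ℝ)) t,
    intervalIntegral.integral_div, integral_pow, Nat.factorial_succ]
  push_cast
  simp [div_div]

lemma sigCoeff_timeAug_replicate_zero {d : ℕ} {X : ℝ → Fin d → ℝ} (hX : ContDiff ℝ 1 X) (n : ℕ)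
    {s t : ℝ} (h : s ≤ t) :
    sigCoeff (timeAug X) s t (List.replicate n 0) = (t - s) ^ n / (n.factorial : ℝ) := by
  induction n generalizing s with
  | zero =>
    simp [sigCoeff, Measure.real, volume_pi]
  | succ n ih =>
    rw [List.replicate_succ, sigCoeff_cons (contDiff_timeAug hX),
      ← setIntegral_Ioo_sub_pow_div_factorial n h]
    refine setIntegral_congr_fun measurableSet_Ioo fun x hx => ?_
    simp [timeAug, ih hx.2.le]

lemma sigCoeff_timeAug_succ_cons_replicate_zero {d : ℕ} {X : ℝ → Fin d → ℝ}
    (hX : ContDiff ℝ 1 X) (n : ℕ) {s t : ℝ} (h : s ≤ t) (i : Fin d) :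
    sigCoeff (timeAug X) s t (i.succ :: List.replicate n 0) =
      (∫ x in s..t, deriv (fun r => X r i) x * (t - x) ^ n) / (n.factorial : ℝ) := by
  rw [sigCoeff_cons (contDiff_timeAug hX), ← intervalIntegral.integral_div,
    intervalIntegral.integral_of_le h, integral_Ioc_eq_integral_Ioo]
  refine setIntegral_congr_fun measurableSet_Ioo fun x hx => ?_
  simp [timeAug, sigCoeff_timeAug_replicate_zero hX n hx.2.le, mul_div_assoc]

/-- A continuous function on a compact interval all of whose moments vanish is zero. -/
lemma eqOn_zero_of_forall_integral_mul_pow_eq_zero {a b : ℝ} (hab : a < b) {g : ℝ → ℝ}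
    (hg : Continuous g) (h : ∀ n : ℕ, ∫ x in a..b, g x * x ^ n = 0) :
    ∀ x ∈ Set.Icc a b, g x = 0 := by
  have hpoly (p : Polynomial ℝ) : ∫ x in a..b, g x * p.eval x = 0 := by
    simp only [Polynomial.eval_eq_sum_range, Finset.mul_sum]
    rw [intervalIntegral.integral_finsetSum
      fun i _ => Continuous.intervalIntegrable (by fun_prop) _ _]
    refine Finset.sum_eq_zero fun i _ => ?_
    simp_rw [mul_left_comm (g _)]
    rw [intervalIntegral.integral_const_mul, h, mul_zero]
  have hle : ∀ ε > 0, ∫ x in a..b, g x * g x ≤ ε * ∫ x in a..b, |g x| := by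
    intro ε hε
    obtain ⟨p, hp⟩ := exists_polynomial_near_of_continuousOn a b g hg.continuousOn ε hε
    have hsub : ∫ x in a..b, g x * g x = ∫ x in a..b, g x * (g x - p.eval x) := by
      simp only [mul_sub]
      rw [intervalIntegral.integral_sub (Continuous.intervalIntegrable (by fun_prop) _ _)
        (Continuous.intervalIntegrable (by fun_prop) _ _), hpoly, sub_zero]
    rw [hsub, ← intervalIntegral.integral_const_mul]
    refine intervalIntegral.integral_mono_on hab.le
      ((hg.mul (hg.sub p.continuous)).intervalIntegrable _ _)
      ((continuous_const.mul hg.abs).intervalIntegrable _ _) fun x hx => ?_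
    refine (le_abs_self _).trans ?_
    rw [abs_mul, mul_comm, abs_sub_comm]
    exact mul_le_mul_of_nonneg_right (hp x hx).le (abs_nonneg _)
  have hsq : ∫ x in a..b, g x * g x ≤ 0 := by
    have hlim : Filter.Tendsto (fun ε : ℝ => ε * ∫ x in a..b, |g x|)
        (nhdsWithin 0 (Set.Ioi 0)) (nhds 0) := by
      have hc : Continuous fun ε : ℝ => ε * ∫ x in a..b, |g x| := by fun_prop
      simpa using (hc.tendsto 0).mono_left nhdsWithin_le_nhds
    exact ge_of_tendsto hlim (Filter.eventually_of_mem self_mem_nhdsWithin hle)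
  intro x hx
  by_contra hne
  exact hsq.not_gt (intervalIntegral.integral_pos hab (hg.mul hg).continuousOn
    (fun y _ => mul_self_nonneg (g y)) ⟨x, hx, mul_self_pos.2 hne⟩)

/-- **Uniqueness of the signature for time-augmented paths.** If two continuously
differentiable paths `X, Y : [0,T] → ℝ^d` with `X_0 = Y_0` have time-augmentations with
equal signature coefficients over `[0,T]` for every multi-index over `{0,1,…,d}`, then
`X_t = Y_t` for all `t ∈ [0,T]`. -/
theorem signature_uniqueness {d : ℕ} (T : ℝ) (hT : 0 ≤ T) (X Y : ℝ → Fin d → ℝ)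
    (hX : ContDiff ℝ 1 X) (hY : ContDiff ℝ 1 Y) (h0 : X 0 = Y 0)
    (hsig : ∀ I : List (Fin (d + 1)),
      sigCoeff (timeAug X) 0 T I = sigCoeff (timeAug Y) 0 T I) :
    ∀ t ∈ Set.Icc (0:ℝ) T, X t = Y t := by
  intro t ht
  rcases hT.eq_or_lt with rfl | hT'
  · rwa [le_antisymm ht.2 ht.1]
  funext i
  have hXi := contDiff_pi.1 hX i
  have hYi := contDiff_pi.1 hY i
  have hcX := hXi.continuous_deriv le_rfl
  have hcY := hYi.continuous_deriv le_rfl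
  have hmom (n : ℕ) : ∫ x in (0 : ℝ)..T,
      (deriv (fun r => X r i) (T - x) - deriv (fun r => Y r i) (T - x)) * x ^ n = 0 := by
    have key := hsig (i.succ :: List.replicate n 0)
    rw [sigCoeff_timeAug_succ_cons_replicate_zero hX n hT,
      sigCoeff_timeAug_succ_cons_replicate_zero hY n hT,
      div_left_inj' (by positivity), ← sub_eq_zero, ← intervalIntegral.integral_sub
        (Continuous.intervalIntegrable (by fun_prop) _ _)
        (Continuous.intervalIntegrable (by fun_prop) _ _)] at key
    have hsubst := intervalIntegral.integral_comp_sub_left (a := 0) (b := T)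
      (fun x => deriv (fun r => X r i) x * (T - x) ^ n - deriv (fun r => Y r i) x * (T - x) ^ n) T
    simp only [sub_sub_cancel, sub_self, sub_zero] at hsubst
    simpa only [key, sub_mul] using hsubst
  have hzero := eqOn_zero_of_forall_integral_mul_pow_eq_zero hT' (by fun_prop) hmom
  have hderiv : ∀ x ∈ Set.uIcc 0 t, deriv (fun r => X r i) x = deriv (fun r => Y r i) x := by
    intro x hx
    rw [Set.uIcc_of_le ht.1] at hx
    have := hzero (T - x) ⟨by linarith [hx.2, ht.2], by linarith [hx.1]⟩
    rwa [sub_sub_cancel, sub_eq_zero] at this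
  have hftc := intervalIntegral.integral_congr (μ := volume) hderiv
  rw [intervalIntegral.integral_deriv_eq_sub
      (fun x _ => (hXi.differentiable one_ne_zero).differentiableAt)
      (hcX.intervalIntegrable _ _),
    intervalIntegral.integral_deriv_eq_sub
      (fun x _ => (hYi.differentiable one_ne_zero).differentiableAt)
      (hcY.intervalIntegrable _ _), h0] at hftc
  exact sub_left_injective hftc
end
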